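/- Let X be a Tychonoff (completely regular Hausdorff) topological space. Then B_1(X) is a Baire space if and only if every pairwise disjoint sequence {Δ_n : n ∈ ℕ} of nonempty finite subsets of X has a strongly Coz_δ-disjoint subsequence. -/

import Mathlib

open Set Topology Filter

/-- A real-valued function on a topological space is *Baire-one* if it is the
pointwise limit of a sequence of continuous real-valued functions. -/
def BaireOne {X : Type*} [TopologicalSpace X] (f : X → ℝ) : Prop :=
  ∃ g : ℕ → X → ℝ, (∀ n, Continuous (g n)) ∧
    ∀ x, Filter.Tendsto (fun n => g n x) Filter.atTop (nhds (f x))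

/-- A *zero-set* is the preimage of `{0}` under a continuous real-valued function. -/
def IsZeroSet {X : Type*} [TopologicalSpace X] (s : Set X) : Prop :=
  ∃ f : X → ℝ, Continuous f ∧ s = f ⁻¹' {0}

/-- A *cozero-set* is the complement of a zero-set. -/
def IsCozeroSet {X : Type*} [TopologicalSpace X] (s : Set X) : Prop :=
  IsZeroSet sᶜ

/-- A *Coz_δ-set* is a countable intersection of cozero-sets. -/
def IsCozDelta {X : Type*} [TopologicalSpace X] (s : Set X) : Prop :=
  ∃ F : ℕ → Set X, (∀ n, IsCozeroSet (F n)) ∧ s = ⋂ n, F n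

/-- A *Zer_σ-set* is a countable union of zero-sets. -/
def IsZerSigma {X : Type*} [TopologicalSpace X] (s : Set X) : Prop :=
  ∃ F : ℕ → Set X, (∀ n, IsZeroSet (F n)) ∧ s = ⋃ n, F n

/-- A family of Coz_δ-subsets is *completely Coz_δ-additive* if the union of every
subfamily is a Coz_δ-set. -/
def CompletelyCozDeltaAdditive {X : Type*} [TopologicalSpace X] {ι : Type*}
    (F : ι → Set X) : Prop :=
  (∀ i, IsCozDelta (F i)) ∧ ∀ S : Set ι, IsCozDelta (⋃ i ∈ S, F i)

/-- A set `A ⊆ X` is *strongly Coz_δ-disjoint* if there is a pairwise disjoint,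
completely Coz_δ-additive family of Coz_δ-sets `F a` with `a ∈ F a` for every `a ∈ A`. -/
def StronglyCozDeltaDisjoint {X : Type*} [TopologicalSpace X] (A : Set X) : Prop :=
  ∃ F : A → Set X, (∀ a : A, (a : X) ∈ F a) ∧
    (Pairwise fun a b : A => Disjoint (F a) (F b)) ∧
    CompletelyCozDeltaAdditive F

section ZerSigma

variable {X : Type*} [TopologicalSpace X]

lemma isZerSigma_eq_zero {f : X → ℝ} (hf : Continuous f) : IsZerSigma {x | f x = 0} :=
  ⟨fun _ => {x | f x = 0}, fun _ => ⟨f, hf, rfl⟩, (iUnion_const _).symm⟩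

lemma isZerSigma_ne_zero {f : X → ℝ} (hf : Continuous f) : IsZerSigma {x | f x ≠ 0} := by
  refine ⟨fun n => {x | 1 / ((n : ℝ) + 1) ≤ |f x|}, fun n =>
    ⟨fun x => max 0 (1 / ((n : ℝ) + 1) - |f x|), by fun_prop, ?_⟩, ?_⟩
  · ext x
    simp
  · ext x
    simp only [mem_ofPred_eq, mem_iUnion]
    constructor
    · intro hx
      obtain ⟨n, hn⟩ := exists_nat_one_div_lt (abs_pos.2 hx)
      exact ⟨n, hn.le⟩
    · rintro ⟨n, hn⟩ hx
      rw [hx, abs_zero] at hn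
      have : 0 < 1 / ((n : ℝ) + 1) := by positivity
      linarith

lemma IsZerSigma.exists_seq {s : Set X} (hs : IsZerSigma s) :
    ∃ z : ℕ → X → ℝ, (∀ n, Continuous (z n)) ∧ ∀ x, x ∈ s ↔ ∃ n, z n x = 0 := by
  obtain ⟨F, hF, rfl⟩ := hs
  choose z hz hz' using hF
  refine ⟨z, hz, fun x => ?_⟩
  simp [hz']

lemma isZerSigma_iUnion {ι : Type*} [Countable ι] {s : ι → Set X}
    (hs : ∀ i, IsZerSigma (s i)) : IsZerSigma (⋃ i, s i) := by
  rcases isEmpty_or_nonempty ι with h | h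
  · have : (⋃ i, s i) = {x | (fun _ : X => (1 : ℝ)) x = 0} := by ext; simp
    rw [this]
    exact isZerSigma_eq_zero continuous_const
  · choose F hF hF' using hs
    obtain ⟨e, he⟩ := exists_surjective_nat (ι × ℕ)
    refine ⟨fun n => F (e n).1 (e n).2, fun n => hF _ _, ?_⟩
    ext x
    simp only [hF', mem_iUnion]
    constructor
    · rintro ⟨i, j, h⟩
      obtain ⟨n, hn⟩ := he (i, j)
      exact ⟨n, by rw [hn]; exact h⟩
    · rintro ⟨n, h⟩
      exact ⟨_, _, h⟩

lemma IsZerSigma.union {s t : Set X} (hs : IsZerSigma s) (ht : IsZerSigma t) :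
    IsZerSigma (s ∪ t) := by
  rw [Set.union_eq_iUnion]
  exact isZerSigma_iUnion fun b => by cases b <;> assumption

lemma IsZerSigma.inter {s t : Set X} (hs : IsZerSigma s) (ht : IsZerSigma t) :
    IsZerSigma (s ∩ t) := by
  obtain ⟨u, hu, hu'⟩ := hs.exists_seq
  obtain ⟨v, hv, hv'⟩ := ht.exists_seq
  have : s ∩ t = ⋃ p : ℕ × ℕ, {x | |u p.1 x| + |v p.2 x| = 0} := by
    ext x
    simp only [mem_inter_iff, hu', hv', mem_iUnion, mem_ofPred_eq, Prod.exists,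
      exists_and_exists_comm]
    refine exists_congr fun i => exists_congr fun j => ?_
    rw [add_eq_zero_iff_of_nonneg (abs_nonneg _) (abs_nonneg _), abs_eq_zero, abs_eq_zero]
  rw [this]
  exact isZerSigma_iUnion fun p => isZerSigma_eq_zero (by have := hu p.1; have := hv p.2; fun_prop)

lemma isCozDelta_iff_compl {s : Set X} : IsCozDelta s ↔ IsZerSigma sᶜ := by
  constructor
  · rintro ⟨F, hF, rfl⟩
    exact ⟨fun n => (F n)ᶜ, hF, by rw [compl_iInter]⟩
  · rintro ⟨F, hF, h⟩
    refine ⟨fun n => (F n)ᶜ, fun n => by rw [IsCozeroSet, compl_compl]; exact hF n, ?_⟩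
    rw [← compl_iUnion, ← h, compl_compl]

/-- Reduction property: two `Zer_σ`-sets covering the space contain complementary `Zer_σ`-sets. -/
lemma IsZerSigma.exists_reduction {s t : Set X} (hs : IsZerSigma s) (ht : IsZerSigma t)
    (h : s ∪ t = univ) :
    ∃ e : Set X, e ⊆ s ∧ eᶜ ⊆ t ∧ IsZerSigma e ∧ IsZerSigma eᶜ := by
  classical
  obtain ⟨u, hu, hu'⟩ := hs.exists_seq
  obtain ⟨v, hv, hv'⟩ := ht.exists_seq
  set e : Set X := ⋃ i, {x | u i x = 0} ∩ {x | ∏ j ∈ Finset.range i, v j x ≠ 0} with he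
  have hmem : ∀ x, x ∈ e ↔ ∃ i, u i x = 0 ∧ ∀ j < i, v j x ≠ 0 := by
    intro x
    simp [he, Finset.prod_eq_zero_iff]
  have hcompl : eᶜ =
      ⋃ j, {x | v j x = 0} ∩ {x | ∏ i ∈ Finset.range (j + 1), u i x ≠ 0} := by
    ext x
    rw [mem_compl_iff, hmem]
    simp only [mem_iUnion, mem_inter_iff, mem_ofPred_eq, Finset.prod_ne_zero_iff,
      Finset.mem_range]
    constructor
    · intro hx
      have hxt : ∃ j, v j x = 0 := by
        rcases (h ▸ mem_univ x : x ∈ s ∪ t) with hxs | hxt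
        · obtain ⟨i, hi⟩ := (hu' x).1 hxs
          by_contra! hc
          exact hx ⟨i, hi, fun j _ => hc j⟩
        · exact (hv' x).1 hxt
      refine ⟨Nat.find hxt, Nat.find_spec hxt, fun i hi hui => hx ⟨i, hui, fun j hj => ?_⟩⟩
      exact Nat.find_min hxt (by omega)
    · rintro ⟨j, hj, hju⟩ ⟨i, hi, hiv⟩
      rcases lt_or_ge j i with hji | hij
      · exact hiv j hji hj
      · exact hju i (by omega) hi
  refine ⟨e, fun x hx => ?_, fun x hx => ?_, ?_, ?_⟩
  · obtain ⟨i, hi, -⟩ := (hmem x).1 hx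
    exact (hu' x).2 ⟨i, hi⟩
  · rw [hcompl] at hx
    obtain ⟨j, hj⟩ := mem_iUnion.1 hx
    exact (hv' x).2 ⟨j, hj.1⟩
  · exact isZerSigma_iUnion fun i => (isZerSigma_eq_zero (hu i)).inter
      (isZerSigma_ne_zero (continuous_finsetProd _ fun j _ => hv j))
  · rw [hcompl]
    exact isZerSigma_iUnion fun i => (isZerSigma_eq_zero (hv i)).inter
      (isZerSigma_ne_zero (continuous_finsetProd _ fun j _ => hu j))

lemma exists_continuous_eq_zero_iff_forall {ι : Type*} [Countable ι] {f : ι → X → ℝ}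
    (hf : ∀ i, Continuous (f i)) :
    ∃ z : X → ℝ, Continuous z ∧ ∀ x, z x = 0 ↔ ∀ i, f i x = 0 := by
  cases nonempty_encodable ι
  obtain ⟨b, hb, c, hbc, -⟩ := posSumOfEncodable one_pos ι
  have hnonneg : ∀ i x, 0 ≤ b i * min 1 |f i x| := fun i x =>
    mul_nonneg (hb i).le (le_min zero_le_one (abs_nonneg _))
  have hle : ∀ i x, b i * min 1 |f i x| ≤ b i := fun i x =>
    mul_le_of_le_one_right (hb i).le (min_le_left _ _)
  refine ⟨fun x => ∑' i, b i * min 1 |f i x|, ?_, fun x => ?_⟩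
  · refine continuous_tsum (u := b)
      (fun i => continuous_const.mul (continuous_const.min (hf i).abs)) hbc.summable fun i x => ?_
    rw [Real.norm_of_nonneg (hnonneg i x)]
    exact hle i x
  · have hs : Summable fun i => b i * min 1 |f i x| :=
      hbc.summable.of_nonneg_of_le (fun i => hnonneg i x) fun i => hle i x
    rw [← hs.hasSum_iff, hasSum_zero_iff_of_nonneg fun i => hnonneg i x, funext_iff]
    refine forall_congr' fun i => ?_
    rw [Pi.zero_apply, mul_eq_zero, or_iff_right (hb i).ne']
    constructor
    · intro h
      by_contra hne
      exact (lt_min one_pos (abs_pos.2 hne)).ne' h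
    · intro h
      simp [h]

/-- A function constant on each piece of a countable `Zer_σ`-partition is Baire-one. -/
lemma exists_baireOne_of_partition {C : ℕ → Set X} (hC : ∀ n, IsZerSigma (C n))
    (hd : Pairwise fun m n => Disjoint (C m) (C n)) (hU : ⋃ n, C n = univ) (g : ℕ → ℝ) :
    ∃ f : X → ℝ, BaireOne f ∧ ∀ n, ∀ x ∈ C n, f x = g n := by
  classical
  choose u hu hu' using fun n => (hC n).exists_seq
  set z : ℕ → ℕ → X → ℝ := fun k n x => ∏ j ∈ Finset.range k, u n j x with hz
  have hzc : ∀ k n, Continuous (z k n) := fun k n => continuous_finsetProd _ fun j _ => hu n j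
  have hz0 : ∀ k n x, z k n x = 0 → x ∈ C n := by
    intro k n x h
    obtain ⟨j, -, hj⟩ := Finset.prod_eq_zero_iff.1 h
    exact (hu' n x).2 ⟨j, hj⟩
  have huniq : ∀ m n x, x ∈ C m → x ∈ C n → m = n := by
    intro m n x hm hn
    by_contra hmn
    exact disjoint_left.1 (hd hmn) hm hn
  choose N hN using fun x => mem_iUnion.1 (hU ▸ mem_univ x : x ∈ ⋃ n, C n)
  set w : ℕ → ℕ → X → ℝ := fun k n x => ∏ m ∈ (Finset.range k).erase n, |z k m x| with hw
  have hwc : ∀ k n, Continuous (w k n) :=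
    fun k n => continuous_finsetProd _ fun m _ => (hzc k m).abs
  have hw0 : ∀ k n x, 0 ≤ w k n x := fun k n x => Finset.prod_nonneg fun _ _ => abs_nonneg _
  have hden : ∀ k n x, |z k n x| + w k n x ≠ 0 := by
    intro k n x h
    rw [add_eq_zero_iff_of_nonneg (abs_nonneg _) (hw0 k n x), abs_eq_zero] at h
    obtain ⟨m, hm, hm'⟩ := Finset.prod_eq_zero_iff.1 h.2
    exact (Finset.mem_erase.1 hm).1
      (huniq _ _ x (hz0 _ _ _ (abs_eq_zero.1 hm')) (hz0 _ _ _ h.1))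
  refine ⟨fun x => g (N x), ⟨fun k x => ∑ n ∈ Finset.range k,
    g n * (w k n x / (|z k n x| + w k n x)), fun k => ?_, fun x => ?_⟩, fun n x hx => ?_⟩
  · refine continuous_finsetSum _ fun n _ => continuous_const.mul ?_
    exact (hwc k n).div ((hzc k n).abs.add (hwc k n)) (hden k n)
  · refine tendsto_const_nhds.congr' ?_
    obtain ⟨j, hj⟩ := (hu' (N x) x).1 (hN x)
    filter_upwards [eventually_gt_atTop (N x), eventually_gt_atTop j] with k hk hjk
    have hzx : z k (N x) x = 0 := Finset.prod_eq_zero (Finset.mem_range.2 hjk) hj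
    rw [Finset.sum_eq_single_of_mem (N x) (Finset.mem_range.2 hk)]
    · have := hden k (N x) x
      rw [hzx, abs_zero, zero_add] at this ⊢
      rw [div_self this, mul_one]
    · intro m _ hm
      have : w k m x = 0 := Finset.prod_eq_zero
        (Finset.mem_erase.2 ⟨hm.symm, Finset.mem_range.2 hk⟩) (by rw [hzx, abs_zero])
      rw [this, zero_div, mul_zero]
  · exact congrArg g (huniq _ _ x (hN x) hx)

end ZerSigma

section BaireOne

variable {X : Type*} [TopologicalSpace X]

lemma Continuous.baireOne {f : X → ℝ} (hf : Continuous f) : BaireOne f :=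
  ⟨fun _ => f, fun _ => hf, fun _ => tendsto_const_nhds⟩

lemma BaireOne.add {f g : X → ℝ} (hf : BaireOne f) (hg : BaireOne g) :
    BaireOne fun x => f x + g x := by
  obtain ⟨u, hu, hu'⟩ := hf
  obtain ⟨v, hv, hv'⟩ := hg
  exact ⟨fun n x => u n x + v n x, fun n => (hu n).add (hv n), fun x => (hu' x).add (hv' x)⟩

lemma BaireOne.comp_left {f : X → ℝ} (hf : BaireOne f) {h : ℝ → ℝ} (hh : Continuous h) :
    BaireOne fun x => h (f x) := by
  obtain ⟨u, hu, hu'⟩ := hf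
  exact ⟨fun n x => h (u n x), fun n => hh.comp (hu n),
    fun x => (hh.tendsto _).comp (hu' x)⟩

lemma BaireOne.sum {ι : Type*} (s : Finset ι) {f : ι → X → ℝ} (hf : ∀ i, BaireOne (f i)) :
    BaireOne fun x => ∑ i ∈ s, f i x := by
  classical
  induction s using Finset.induction_on with
  | empty => simpa using (continuous_const (y := (0 : ℝ))).baireOne
  | insert i s hi ih => simpa [Finset.sum_insert hi] using (hf i).add ih

lemma BaireOne.tsum {f : ℕ → X → ℝ} (hf : ∀ n, BaireOne (f n)) {b : ℕ → ℝ}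
    (hb : Summable b) (hfb : ∀ n x, |f n x| ≤ b n) : BaireOne fun x => ∑' n, f n x := by
  choose u hu hu' using hf
  have hclamp : ∀ n t, |max (-b n) (min (b n) t)| ≤ |b n| := by
    intro n t
    rw [abs_le]
    constructor
    · exact (neg_le_neg (le_abs_self _)).trans (le_max_left _ _)
    · exact max_le (neg_le_abs _) ((min_le_left _ _).trans (le_abs_self _))
  refine ⟨fun k x => ∑' n, max (-b n) (min (b n) (u n k x)), fun k => ?_, fun x => ?_⟩
  · exact continuous_tsum (u := fun n => |b n|)
      (fun n => continuous_const.max (continuous_const.min (hu n k))) hb.abs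
      fun n x => hclamp n _
  · refine tendsto_tsum_of_dominated_convergence (bound := fun n => |b n|) hb.abs (fun n => ?_)
      (Eventually.of_forall fun k n => hclamp n _)
    have h1 : f n x = max (-b n) (min (b n) (f n x)) := by
      have := abs_le.1 (hfb n x)
      rw [min_eq_right this.2, max_eq_right this.1]
    rw [h1]
    exact tendsto_const_nhds.max (tendsto_const_nhds.min (hu' n x))

lemma baireOne_indicator_eq_zero {z : X → ℝ} (hz : Continuous z) (c : ℝ) :
    BaireOne ({x | z x = 0}.indicator fun _ => c) := by
  have hpos : ∀ x, 0 < 1 + |z x| := fun x => by positivity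
  refine ⟨fun n x => c * (1 / (1 + |z x|)) ^ n, fun n => ?_, fun x => ?_⟩
  · exact continuous_const.mul
      ((continuous_const.div (continuous_const.add hz.abs) fun x => (hpos x).ne').pow n)
  · by_cases hx : z x = 0
    · simp [hx]
    · rw [indicator_of_notMem (by exact hx), ← mul_zero c]
      refine (tendsto_pow_atTop_nhds_zero_of_lt_one (by positivity) ?_).const_mul c
      rw [div_lt_one (hpos x)]
      have := abs_pos.2 hx
      linarith

lemma BaireOne.isZerSigma_preimage {f : X → ℝ} (hf : BaireOne f) {O : Set ℝ} (hO : IsOpen O) :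
    IsZerSigma (f ⁻¹' O) := by
  rcases (Oᶜ).eq_empty_or_nonempty with hne | hne
  · rw [compl_empty_iff.1 hne]
    simpa using isZerSigma_eq_zero (continuous_const (X := X) (y := (0 : ℝ)))
  obtain ⟨u, hu, hu'⟩ := hf.comp_left (Metric.continuous_infDist_pt Oᶜ)
  have hmem : ∀ x, x ∈ f ⁻¹' O ↔ 0 < Metric.infDist (f x) Oᶜ := by
    intro x
    rw [← hO.isClosed_compl.notMem_iff_infDist_pos hne]
    simp
  have hcont : ∀ p : ℕ × ℕ, ∀ n : ℕ,
      Continuous fun x => max 0 (1 / ((p.1 : ℝ) + 1) - u (p.2 + n) x) :=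
    fun p n => continuous_const.max (continuous_const.sub (hu _))
  choose z hz hz' using fun p => exists_continuous_eq_zero_iff_forall (hcont p)
  have : f ⁻¹' O = ⋃ p : ℕ × ℕ, {x | z p x = 0} := by
    ext x
    rw [hmem]
    simp only [mem_iUnion, mem_ofPred_eq, hz', max_eq_left_iff, sub_nonpos, Prod.exists]
    constructor
    · intro h
      obtain ⟨k, hk⟩ := exists_nat_one_div_lt h
      obtain ⟨m, hm⟩ := eventually_atTop.1 ((hu' x).eventually_const_lt hk)
      exact ⟨k, m, fun n => (hm _ (by omega)).le⟩
    · rintro ⟨k, m, h⟩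
      have h1 : 1 / ((k : ℝ) + 1) ≤ Metric.infDist (f x) Oᶜ :=
        ge_of_tendsto (hu' x) (eventually_atTop.2 ⟨m, fun n hn => by
          obtain ⟨j, rfl⟩ := Nat.exists_eq_add_of_le hn
          exact h j⟩)
      exact lt_of_lt_of_le (by positivity) h1
  rw [this]
  exact isZerSigma_iUnion fun p => isZerSigma_eq_zero (hz p)

end BaireOne

section Interpolation

variable {X : Type*} [TopologicalSpace X] [T35Space X]

lemma exists_continuous_eq_zero_ne_zero {Y : Set X} (hY : Y.Countable) (k : X) :
    ∃ z : X → ℝ, Continuous z ∧ z k = 0 ∧ ∀ y ∈ Y, y ≠ k → z y ≠ 0 := by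
  have : Countable ↥(Y \ {k}) := (hY.mono sdiff_subset).to_subtype
  have hsep : ∀ y : ↥(Y \ {k}), ∃ f : X → ℝ, Continuous f ∧ f k = 0 ∧ f y = 1 := by
    rintro ⟨y, -, hyk⟩
    obtain ⟨f, hf, hf0, hf1⟩ := CompletelyRegularSpace.completely_regular k {y}
      isClosed_singleton fun h => hyk h.symm
    exact ⟨fun x => f x, continuous_subtype_val.comp hf, by simp [hf0], by simp [hf1 rfl]⟩
  choose f hf hf0 hf1 using hsep
  obtain ⟨z, hz, hz'⟩ := exists_continuous_eq_zero_iff_forall hf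
  refine ⟨z, hz, (hz' k).2 hf0, fun y hy hyk h => ?_⟩
  have := (hz' y).1 h ⟨y, hy, hyk⟩
  rw [hf1] at this
  exact one_ne_zero this

lemma exists_baireOne_eqOn_finset {Y : Set X} (hY : Y.Countable) (K : Finset X)
    {v : X → ℝ} {b : ℝ} (hb : 0 ≤ b) (hv : ∀ x ∈ K, |v x| ≤ b) :
    ∃ u : X → ℝ, BaireOne u ∧ (∀ x ∈ K, u x = v x) ∧ (∀ x ∈ Y, x ∉ K → u x = 0) ∧
      ∀ x, |u x| ≤ b := by
  classical
  choose z hz hzk hzY using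
    exists_continuous_eq_zero_ne_zero (hY.union K.countable_toSet)
  set w : X → ℝ := fun x => ∑ k ∈ K, {x | z k x = 0}.indicator (fun _ => v k) x with hw
  have hwB : BaireOne w := BaireOne.sum K fun k => baireOne_indicator_eq_zero (hz k) (v k)
  have hne : ∀ k, ∀ x ∈ Y ∪ K, x ≠ k → {x | z k x = 0}.indicator (fun _ => v k) x = 0 :=
    fun k x hx hxk => indicator_of_notMem (s := {x | z k x = 0}) (hzY k x hx hxk) _
  refine ⟨fun x => max (-b) (min b (w x)), hwB.comp_left
    (h := fun t => max (-b) (min b t)) (by fun_prop), fun x hx => ?_, fun x hx hxK => ?_, fun x => ?_⟩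
  · have : w x = v x := by
      rw [hw]
      dsimp only
      rw [Finset.sum_eq_single_of_mem x hx fun k _ hk => hne k x (Or.inr hx) hk.symm]
      exact indicator_of_mem (s := {y | z x y = 0}) (hzk x) _
    have h := abs_le.1 (hv x hx)
    dsimp only
    rw [this, min_eq_right h.2, max_eq_right h.1]
  · have : w x = 0 := Finset.sum_eq_zero fun k hk =>
      hne k x (Or.inl hx) fun h => hxK (h ▸ hk)
    dsimp only
    rw [this, min_eq_right hb, max_eq_right (neg_nonpos.2 hb)]
  · exact abs_le.2 ⟨le_max_left _ _, max_le (by linarith) (min_le_left _ _)⟩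

lemma exists_baireOne_eqOn (K : Finset X) (v : X → ℝ) :
    ∃ u : X → ℝ, BaireOne u ∧ ∀ x ∈ K, u x = v x := by
  obtain ⟨u, hu, huK, -⟩ := exists_baireOne_eqOn_finset countable_empty K (v := v)
    (Finset.sum_nonneg fun x _ => abs_nonneg (v x))
    fun x hx => Finset.single_le_sum (f := fun x => |v x|) (fun _ _ => abs_nonneg _) hx
  exact ⟨u, hu, huK⟩

/-- Arbitrary values on a countable strongly `Coz_δ`-disjoint set, extended by zero on the rest of
a countable set, are attained by a Baire-one function. -/
lemma StronglyCozDeltaDisjoint.exists_baireOne {A Y : Set X} (hA : StronglyCozDeltaDisjoint A)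
    (hAY : A ⊆ Y) (hY : Y.Countable) (g : X → ℝ) :
    ∃ f : X → ℝ, BaireOne f ∧ (∀ x ∈ A, f x = g x) ∧ ∀ x ∈ Y, x ∉ A → f x = 0 := by
  classical
  obtain ⟨F, hF, hFd, -, hFadd⟩ := hA
  have : Countable A := (hY.mono hAY).to_subtype
  cases nonempty_encodable A
  choose z hz hzk hzY using exists_continuous_eq_zero_ne_zero hY
  -- the family transported to subsets of `ℕ`
  set P : Set ℕ → Set X := fun S => ⋃ a ∈ {a : A | Encodable.encode a ∈ S}, F a with hP
  have hPcoz : ∀ S, IsZerSigma (P S)ᶜ := fun S => isCozDelta_iff_compl.1 (hFadd _)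
  have hPmem : ∀ S x, x ∈ P S ↔ ∃ a : A, Encodable.encode a ∈ S ∧ x ∈ F a := by
    intro S x
    simp [hP]
  have hPd : ∀ S T x, x ∈ P S → x ∈ P T → ∃ n, n ∈ S ∧ n ∈ T := by
    intro S T x hS hT
    obtain ⟨a, haS, ha⟩ := (hPmem S x).1 hS
    obtain ⟨b, hbT, hb⟩ := (hPmem T x).1 hT
    have hab : a = b := by
      by_contra hab
      exact disjoint_left.1 (hFd hab) ha hb
    exact ⟨_, haS, hab ▸ hbT⟩
  have hsep : ∀ n, ∃ e : Set X, P {n} ⊆ e ∧ (∀ x ∈ e, x ∉ P {n}ᶜ) ∧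
      IsZerSigma e ∧ IsZerSigma eᶜ := by
    intro n
    obtain ⟨e, he, he', hz, hz'⟩ := (hPcoz {n}ᶜ).exists_reduction (hPcoz {n}) (by
      ext x
      simp only [mem_union, mem_compl_iff, mem_univ, iff_true]
      by_contra! h
      obtain ⟨m, hm, hm'⟩ := hPd _ _ x h.1 h.2
      exact hm hm')
    exact ⟨e, compl_subset_compl.1 he', he, hz, hz'⟩
  choose E hPE hEP hE hE' using hsep
  have hE_uniq : ∀ m n x, x ∈ P {n} → x ∈ E m → m = n := by
    intro m n x hx hm
    by_contra hmn
    refine hEP m x hm ((hPmem _ x).2 ?_)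
    obtain ⟨a, ha, hxa⟩ := (hPmem _ x).1 hx
    exact ⟨a, fun h => hmn (h.symm.trans ha), hxa⟩
  -- a zero-set meeting `Y` only in the point with code `n`
  set ζ : ℕ → X → ℝ := fun n x => if h : ∃ a : A, Encodable.encode a = n
    then z h.choose x else 1 with hζ
  have hζc : ∀ n, Continuous (ζ n) := by
    intro n
    by_cases h : ∃ a : A, Encodable.encode a = n
    · simpa only [hζ, dif_pos h] using hz _
    · simpa only [hζ, dif_neg h] using continuous_const
  have hζa : ∀ a : A, ζ (Encodable.encode a) a = 0 := by
    intro a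
    have h : ∃ b : A, Encodable.encode b = Encodable.encode a := ⟨a, rfl⟩
    have h' : h.choose = a := Encodable.encode_injective h.choose_spec
    simp only [hζ, dif_pos h, h', hzk]
  have hζY : ∀ n, ∀ y ∈ Y, ζ n y = 0 → y ∈ A := by
    intro n y hy h0
    by_cases h : ∃ a : A, Encodable.encode a = n
    · simp only [hζ, dif_pos h] at h0
      by_contra hyA
      exact hzY _ y hy (fun h' => hyA (h' ▸ h.choose.2)) h0
    · simp only [hζ, dif_neg h] at h0
      exact absurd h0 one_ne_zero
  have hlt : ∀ n, IsZerSigma {x | ∀ m < n, x ∉ E m} := by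
    intro n
    induction n with
    | zero => simpa using isZerSigma_eq_zero (continuous_const (X := X) (y := (0 : ℝ)))
    | succ n ih =>
      convert ih.inter (hE' n) using 1
      ext x
      exact Nat.forall_lt_succ_right
  set B : ℕ → Set X := fun n => E n ∩ {x | ∀ m < n, x ∉ E m} ∩ {x | ζ n x = 0} with hB
  have hBZ : ∀ n, IsZerSigma (B n) := fun n =>
    ((hE n).inter (hlt n)).inter (isZerSigma_eq_zero (hζc n))
  have hBd : ∀ m n x, x ∈ B m → x ∈ B n → m = n := by
    rintro m n x ⟨⟨hm, hm'⟩, -⟩ ⟨⟨hn, hn'⟩, -⟩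
    rcases lt_trichotomy m n with h | h | h
    · exact absurd hm (hn' m h)
    · exact h
    · exact absurd hn (hm' n h)
  have hPB : ∀ n x, x ∈ P {n} → ζ n x = 0 → x ∈ B n := fun n x hx h0 =>
    ⟨⟨hPE n hx, fun m hm hxm => hm.ne (hE_uniq m n x hx hxm)⟩, h0⟩
  -- complement of the shrunken family
  set Q : Set X := (P univ)ᶜ ∪ ⋃ n, (E n ∩ {x | ζ n x ≠ 0}) with hQ
  have hQZ : IsZerSigma Q := (hPcoz univ).union
    (isZerSigma_iUnion fun n => (hE n).inter (isZerSigma_ne_zero (hζc n)))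
  obtain ⟨D, hDB, hDQ, hD, hD'⟩ := (isZerSigma_iUnion hBZ).exists_reduction hQZ (by
    ext x
    simp only [mem_univ, iff_true]
    by_cases hx : x ∈ P univ
    · obtain ⟨a, -, ha⟩ := (hPmem _ x).1 hx
      have hxa : x ∈ P {Encodable.encode a} := (hPmem _ x).2 ⟨a, rfl, ha⟩
      by_cases h0 : ζ (Encodable.encode a) x = 0
      · exact Or.inl (mem_iUnion.2 ⟨_, hPB _ x hxa h0⟩)
      · exact Or.inr (Or.inr (mem_iUnion.2 ⟨_, hPE _ hxa, h0⟩))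
    · exact Or.inr (Or.inl hx))
  set C : ℕ → Set X := fun n => Nat.casesOn n Dᶜ fun k => B k ∩ D with hC
  obtain ⟨f, hf, hfC⟩ := exists_baireOne_of_partition (C := C)
    (by rintro (_ | n); exacts [hD', (hBZ n).inter hD])
    (by
      rintro (_ | m) (_ | n) hmn
      · exact absurd rfl hmn
      · exact disjoint_left.2 fun x hx hx' => hx hx'.2
      · exact disjoint_left.2 fun x hx hx' => hx' hx.2
      · exact disjoint_left.2 fun x hx hx' => hmn (by rw [hBd m n x hx.1 hx'.1]))
    (by
      ext x
      simp only [mem_iUnion, mem_univ, iff_true]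
      by_cases hx : x ∈ D
      · obtain ⟨n, hn⟩ := mem_iUnion.1 (hDB hx)
        exact ⟨n + 1, hn, hx⟩
      · exact ⟨0, hx⟩)
    (fun n => Nat.casesOn n 0 fun k =>
      if h : ∃ a : A, Encodable.encode a = k then g h.choose else 0)
  refine ⟨f, hf, fun x hx => ?_, fun x hx hxA => ?_⟩
  · set a : A := ⟨x, hx⟩ with ha
    have hxP : x ∈ P {Encodable.encode a} := (hPmem _ x).2 ⟨a, rfl, hF a⟩
    have hxB : x ∈ B (Encodable.encode a) := hPB _ x hxP (hζa a)
    have hxD : x ∈ D := by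
      by_contra hxD
      rcases hDQ hxD with h | h
      · exact h ((hPmem _ x).2 ⟨a, mem_univ _, hF a⟩)
      · obtain ⟨m, hm, hm0⟩ := mem_iUnion.1 h
        rw [hE_uniq m _ x hxP hm] at hm0
        exact hm0 (hζa a)
    rw [hfC (Encodable.encode a + 1) x ⟨hxB, hxD⟩]
    have h : ∃ b : A, Encodable.encode b = Encodable.encode a := ⟨a, rfl⟩
    have h' : h.choose = a := Encodable.encode_injective h.choose_spec
    exact (dif_pos h).trans (by rw [h'])
  · refine hfC 0 x fun hxD => ?_
    obtain ⟨n, hn⟩ := mem_iUnion.1 (hDB hxD)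
    exact hxA (hζY n x hx hn.2)

end Interpolation

section PointwiseTopology

variable {X : Type*} [TopologicalSpace X]

lemma isOpen_setOf_forall_abs_sub_lt (s : Finset X) (c : X → ℝ) (r : ℝ) :
    IsOpen {f : {f : X → ℝ // BaireOne f} | ∀ x ∈ s, |f.1 x - c x| < r} := by
  simp only [Set.ofPred_forall]
  refine isOpen_biInter_finset fun x _ => isOpen_lt ?_ continuous_const
  exact (((continuous_apply x).comp continuous_subtype_val).sub continuous_const).abs

lemma IsOpen.exists_forall_abs_sub_lt_mem {O : Set {f : X → ℝ // BaireOne f}} (hO : IsOpen O)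
    {f : {f : X → ℝ // BaireOne f}} (hf : f ∈ O) :
    ∃ s : Finset X, ∃ ε > 0, ∀ h : {f : X → ℝ // BaireOne f},
      (∀ x ∈ s, |h.1 x - f.1 x| < ε) → h ∈ O := by
  obtain ⟨U, hU, rfl⟩ := isOpen_induced_iff.1 hO
  obtain ⟨s, u, hu, hsu⟩ := isOpen_pi_iff.1 hU f.1 hf
  have hev : ∀ᶠ ε : ℝ in 𝓝[>] 0, ∀ x ∈ s, Metric.ball (f.1 x) ε ⊆ u x := by
    refine (Filter.eventually_all_finset s).2 fun x hx => ?_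
    obtain ⟨ε, hε, hεu⟩ := Metric.isOpen_iff.1 (hu x hx).1 _ (hu x hx).2
    filter_upwards [Ioc_mem_nhdsGT hε] with δ hδ
    exact (Metric.ball_subset_ball hδ.2).trans hεu
  obtain ⟨ε, hεs, hε⟩ := (hev.and self_mem_nhdsWithin).exists
  exact ⟨s, ε, hε, fun h hh => hsu fun x hx => hεs x hx (hh x hx)⟩

end PointwiseTopology

section BaireImpliesDisjoint

variable {X : Type*} [TopologicalSpace X]

lemma BaireOne.isCozDelta_preimage {f : X → ℝ} (hf : BaireOne f) {C : Set ℝ} (hC : IsClosed C) :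
    IsCozDelta (f ⁻¹' C) :=
  isCozDelta_iff_compl.2 (hf.isZerSigma_preimage hC.isOpen_compl)

/-- A Baire-one function that is uniformly close to an injective integer-valued labelling of a set
witnesses that the set is strongly `Coz_δ`-disjoint. -/
lemma BaireOne.stronglyCozDeltaDisjoint {f : X → ℝ} (hf : BaireOne f) {A : Set X} {i : X → ℕ}
    (hi : InjOn i A) (hfi : ∀ x ∈ A, |f x - i x| < 1 / 3) : StronglyCozDeltaDisjoint A := by
  refine ⟨fun a => f ⁻¹' Metric.closedBall (i a : ℝ) (1 / 3), fun a => (hfi a a.2).le, ?_,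
    fun a => hf.isCozDelta_preimage Metric.isClosed_closedBall, fun S => ?_⟩
  · intro a b hab
    refine Disjoint.preimage f (Metric.closedBall_disjoint_closedBall ?_)
    have hne : i a ≠ i b := fun h => hab (Subtype.ext (hi a.2 b.2 h))
    have : 1 ≤ dist (i a) (i b) := Nat.pairwise_one_le_dist hne
    rw [← Nat.dist_cast_real] at this
    linarith
  · have hcl : IsClosed ((fun n : ℕ => (n : ℝ)) '' ((fun a : A => i a) '' S)) :=
      Nat.isClosedEmbedding_coe_real.isClosedMap _ (isClosed_discrete _)
    have : ⋃ a ∈ S, f ⁻¹' Metric.closedBall (i a : ℝ) (1 / 3) =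
        f ⁻¹' Metric.cthickening (1 / 3)
          ((fun n : ℕ => (n : ℝ)) '' ((fun a : A => i a) '' S)) := by
      rw [hcl.cthickening_eq_biUnion_closedBall (by norm_num), biUnion_image, biUnion_image,
        preimage_iUnion₂]
    rw [this]
    exact hf.isCozDelta_preimage Metric.isClosed_cthickening

lemma exists_ge_disjoint_of_pairwise_disjoint {α : Type*} {Δ : ℕ → Set α}
    (hd : Pairwise fun n m => Disjoint (Δ n) (Δ m)) (s : Finset α) (m : ℕ) :
    ∃ n ≥ m, Disjoint (Δ n) s := by
  by_contra! h
  have h' : ∀ n, ∃ x ∈ Δ (m + n), x ∈ s := fun n =>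
    not_disjoint_iff.1 (h (m + n) (by omega))
  choose x hx hxs using h'
  have hinj : Function.Injective fun n => (⟨x n, hxs n⟩ : s) := by
    intro n k hnk
    by_contra hne
    refine disjoint_left.1 (hd (show m + n ≠ m + k by omega)) (hx n) ?_
    rw [show x n = x k from congrArg Subtype.val hnk]
    exact hx k
  exact not_injective_infinite_finite _ hinj

theorem exists_strictMono_stronglyCozDeltaDisjoint [T35Space X]
    [BaireSpace {f : X → ℝ // BaireOne f}] {Δ : ℕ → Set X} (hfin : ∀ n, (Δ n).Finite)
    (hd : Pairwise fun n m => Disjoint (Δ n) (Δ m)) :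
    ∃ φ : ℕ → ℕ, StrictMono φ ∧ StronglyCozDeltaDisjoint (⋃ k, Δ (φ k)) := by
  classical
  obtain ⟨i, hi⟩ := countable_iff_exists_injOn.1 (countable_iUnion fun n => (hfin n).countable)
  set U : ℕ → Set {f : X → ℝ // BaireOne f} :=
    fun n => {f | ∀ x ∈ (hfin n).toFinset, |f.1 x - i x| < 1 / 3} with hU
  have hUo : ∀ n, IsOpen (U n) := fun n => isOpen_setOf_forall_abs_sub_lt _ _ _
  have hdense : ∀ m, Dense (⋃ n ≥ m, U n) := by
    intro m
    refine dense_iff_inter_open.2 fun O hO ⟨f, hf⟩ => ?_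
    obtain ⟨s, ε, hε, hs⟩ := hO.exists_forall_abs_sub_lt_mem hf
    obtain ⟨n, hn, hns⟩ := exists_ge_disjoint_of_pairwise_disjoint hd s m
    obtain ⟨u, hu, hu'⟩ := exists_baireOne_eqOn (s ∪ (hfin n).toFinset)
      fun x => if x ∈ s then f.1 x else i x
    refine ⟨⟨u, hu⟩, hs _ fun x hx => ?_, mem_iUnion₂.2 ⟨n, hn, fun x hx => ?_⟩⟩
    · simp [hu' x (Finset.mem_union_left _ hx), hx, hε]
    · have hxs : x ∉ s := disjoint_left.1 hns ((hfin n).mem_toFinset.1 hx)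
      simp [hu' x (Finset.mem_union_right _ hx), hxs]
  have : Nonempty {f : X → ℝ // BaireOne f} :=
    ⟨⟨fun _ => 0, (continuous_const (y := (0 : ℝ))).baireOne⟩⟩
  obtain ⟨f, hf⟩ := (dense_iInter_of_isOpen_nat
    (fun m => isOpen_biUnion fun n _ => hUo n) hdense).nonempty
  have hfreq : ∃ᶠ n in atTop, f ∈ U n := by
    refine frequently_atTop.2 fun m => ?_
    obtain ⟨n, hn, hfn⟩ := mem_iUnion₂.1 (mem_iInter.1 hf m)
    exact ⟨n, hn, hfn⟩
  obtain ⟨φ, hφ, hφU⟩ := extraction_of_frequently_atTop hfreq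
  refine ⟨φ, hφ, f.2.stronglyCozDeltaDisjoint
    (hi.mono (iUnion_subset fun k => subset_iUnion Δ (φ k))) fun x hx => ?_⟩
  obtain ⟨k, hk⟩ := mem_iUnion.1 hx
  exact hφU k x ((hfin _).mem_toFinset.2 hk)

end BaireImpliesDisjoint

section DisjointImpliesBaire

/-- Nested boxes have a common point. -/
lemma exists_forall_abs_sub_le_of_nested {X : Type*} {A : ℕ → Finset X} (hA : Monotone A)
    {p : ℕ → (X → ℝ) × ℝ} (hp : ∀ n, 0 ≤ (p n).2)
    (hnest : ∀ n, ∀ x ∈ A n, |(p (n + 1)).1 x - (p n).1 x| + (p (n + 1)).2 ≤ (p n).2) :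
    ∃ v : X → ℝ, ∀ n, ∀ x ∈ A n, |v x - (p n).1 x| ≤ (p n).2 := by
  classical
  suffices h : ∀ x, ∃ t : ℝ, ∀ n, x ∈ A n → |t - (p n).1 x| ≤ (p n).2 by
    choose v hv using h
    exact ⟨v, fun n x hx => hv x n hx⟩
  intro x
  by_cases hx : ∃ n, x ∈ A n
  · set m := Nat.find hx with hm
    have hxm : ∀ k, x ∈ A (m + k) := fun k => hA (Nat.le_add_right m k) (Nat.find_spec hx)
    set I : ℕ → Set ℝ := fun k =>
      Icc ((p (m + k)).1 x - (p (m + k)).2) ((p (m + k)).1 x + (p (m + k)).2) with hI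
    have hI' : ∀ k, I (k + 1) ⊆ I k := by
      intro k
      have h := hnest (m + k) x (hxm k)
      have h1 := abs_le.1 (le_sub_iff_add_le.2 h)
      exact Icc_subset_Icc (by rw [← add_assoc]; linarith) (by rw [← add_assoc]; linarith)
    obtain ⟨t, ht⟩ := IsCompact.nonempty_iInter_of_sequence_nonempty_isCompact_isClosed I hI'
      (fun k => nonempty_Icc.2 (by have := hp (m + k); linarith)) isCompact_Icc
      fun k => isClosed_Icc
    refine ⟨t, fun n hn => ?_⟩
    obtain ⟨k, hk⟩ := Nat.exists_eq_add_of_le (Nat.find_min' hx hn)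
    have := mem_iInter.1 ht k
    rw [hI] at this
    dsimp only at this
    rw [hm, ← hk] at this
    rw [abs_le]
    constructor <;> linarith [this.1, this.2]
  · exact ⟨0, fun n hn => absurd ⟨n, hn⟩ hx⟩

variable {X : Type*} [TopologicalSpace X]

lemma exists_seq_of_forall_exists_succ {α : Type*} {P : ℕ → α → Prop} {R : ℕ → α → α → Prop}
    {a : α} (ha : P 0 a) (h : ∀ n a, P n a → ∃ b, P (n + 1) b ∧ R n a b) :
    ∃ s : ℕ → α, s 0 = a ∧ ∀ n, P n (s n) ∧ R n (s n) (s (n + 1)) := by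
  choose! next hP hR using h
  set s : ℕ → α := fun n => Nat.rec a next n with hs
  have hsP : ∀ n, P n (s n) := by
    intro n
    induction n with
    | zero => exact ha
    | succ n ih => exact hP n _ ih
  exact ⟨s, rfl, fun n => ⟨hsP n, hR n _ (hsP n)⟩⟩

/-- The pairs `p = (c, r)` below stand for the closed box of functions within `r` of `c`. A box
over `A` can be shrunk so as to lie inside a given dense open set. -/
lemma exists_box_subset_of_dense [T35Space X] {G : Set {f : X → ℝ // BaireOne f}}
    (hG : IsOpen G) (hGd : Dense G) (A : Finset X) (p : (X → ℝ) × ℝ) (hp : 0 < p.2) {δ : ℝ}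
    (hδ : 0 < δ) :
    ∃ s : Finset X, ∃ q : (X → ℝ) × ℝ, 0 < q.2 ∧ q.2 ≤ δ ∧
      (∀ x ∈ A, |q.1 x - p.1 x| + q.2 ≤ p.2) ∧
      ∀ f : {f : X → ℝ // BaireOne f}, (∀ x ∈ s, |f.1 x - q.1 x| ≤ q.2) → f ∈ G := by
  obtain ⟨u, hu, hu'⟩ := exists_baireOne_eqOn A p.1
  obtain ⟨f, hfA, hfG⟩ := hGd.inter_open_nonempty _
    (isOpen_setOf_forall_abs_sub_lt A p.1 (p.2 / 2))
    ⟨⟨u, hu⟩, fun x hx => by simpa [hu' x hx] using hp⟩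
  obtain ⟨s, ε, hε, hs⟩ := hG.exists_forall_abs_sub_lt_mem hfG
  refine ⟨s, (f.1, min (min (ε / 2) (p.2 / 2)) δ), by positivity, min_le_right _ _,
    fun x hx => ?_, fun h hh => hs h fun x hx => ?_⟩
  · have h1 := hfA x hx
    have h2 : min (min (ε / 2) (p.2 / 2)) δ ≤ p.2 / 2 :=
      (min_le_left _ _).trans (min_le_right _ _)
    dsimp only
    linarith
  · have h1 := hh x hx
    have h2 : min (min (ε / 2) (p.2 / 2)) δ ≤ ε / 2 :=
      (min_le_left _ _).trans (min_le_left _ _)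
    dsimp only at h1
    linarith

lemma exists_finset_boxes_succ [T35Space X] [Infinite X] {G : Set {f : X → ℝ // BaireOne f}}
    (hG : IsOpen G) (hGd : Dense G) {δ : ℝ} (hδ : 0 < δ) (A : Finset X)
    (L : Finset ((X → ℝ) × ℝ)) (hL : ∀ p ∈ L, 0 < p.2) :
    ∃ (A' : Finset X) (L' : Finset ((X → ℝ) × ℝ)), (∀ q ∈ L', 0 < q.2) ∧ A ⊂ A' ∧
      (∀ p ∈ L, ∃ q ∈ L', q.2 ≤ δ ∧ (∀ x ∈ A, |q.1 x - p.1 x| + q.2 ≤ p.2) ∧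
        ∀ x ∈ A', x ∉ A → q.1 x = 0) ∧
      ∀ p ∈ L, ∃ q ∈ L', q.2 ≤ δ ∧ (∀ x ∈ A, |q.1 x - p.1 x| + q.2 ≤ p.2) ∧
        ∀ f : {f : X → ℝ // BaireOne f}, (∀ x ∈ A', |f.1 x - q.1 x| ≤ q.2) → f ∈ G := by
  classical
  choose! s q hq0 hqδ hqA hqG using
    fun p hp => exists_box_subset_of_dense hG hGd A p (hL p hp) hδ
  obtain ⟨x₀, hx₀⟩ := Infinite.exists_notMem_finset A
  set extend : (X → ℝ) × ℝ → (X → ℝ) × ℝ :=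
    fun p => (fun x => if x ∈ A then p.1 x else 0, min p.2 δ) with hextend
  refine ⟨insert x₀ A ∪ L.biUnion s, L.image extend ∪ L.image q, ?_, ?_, ?_, ?_⟩
  · intro r hr
    rcases Finset.mem_union.1 hr with hr | hr <;> obtain ⟨p, hp, rfl⟩ := Finset.mem_image.1 hr
    · exact lt_min (hL p hp) hδ
    · exact hq0 p hp
  · exact (Finset.ssubset_insert hx₀).trans_subset Finset.subset_union_left
  · refine fun p hp => ⟨extend p, Finset.mem_union_left _ (Finset.mem_image_of_mem _ hp),
      min_le_right _ _, fun x hx => ?_, fun x _ hx => ?_⟩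
    · simp [hextend, hx]
    · simp [hextend, hx]
  · refine fun p hp => ⟨q p, Finset.mem_union_right _ (Finset.mem_image_of_mem _ hp), hqδ p hp,
      hqA p hp, fun f hf => hqG p hp f fun x hx => hf x ?_⟩
    exact Finset.mem_union_right _ (Finset.mem_biUnion.2 ⟨p, hp, hx⟩)

/-- Along an increasing sequence of finite sets with strongly `Coz_δ`-disjoint selected
increments, any values that are summably small on the other increments are attained by a
Baire-one function. -/
lemma exists_baireOne_eqOn_iUnion [T35Space X] {A : ℕ → Finset X} (hA : Monotone A)
    {φ : ℕ → ℕ} (hφ : StronglyCozDeltaDisjoint (⋃ k, (A (φ k + 1) \ A (φ k) : Set X)))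
    {b : ℕ → ℝ} (hb : Summable b) (hb0 : ∀ n, 0 ≤ b n) {v : X → ℝ}
    (hv : ∀ n, n ∉ range φ → ∀ x ∈ A (n + 1), x ∉ A n → |v x| ≤ b n) :
    ∃ f : X → ℝ, BaireOne f ∧ ∀ n, ∀ x ∈ A n, f x = v x := by
  classical
  set Y : Set X := ⋃ n, (A n : Set X) with hYdef
  have hY : Y.Countable := countable_iUnion fun n => (A n).countable_toSet
  have hAY : ∀ n, ∀ x ∈ A n, x ∈ Y := fun n x hx => mem_iUnion.2 ⟨n, hx⟩
  obtain ⟨f₁, hf₁, hf₁φ, hf₁Y⟩ := hφ.exists_baireOne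
    (iUnion_subset fun k x hx => hAY _ x hx.1) hY v
  obtain ⟨f₀, hf₀, hf₀A, hf₀Y, -⟩ := exists_baireOne_eqOn_finset hY (A 0) (v := v)
    (Finset.sum_nonneg fun x _ => abs_nonneg (v x))
    fun x hx => Finset.single_le_sum (f := fun x => |v x|) (fun _ _ => abs_nonneg _) hx
  have hu : ∀ n, ∃ u : X → ℝ, BaireOne u ∧
      (∀ x ∈ A (n + 1) \ A n, u x = if n ∈ range φ then 0 else v x) ∧
      (∀ x ∈ Y, x ∉ A (n + 1) \ A n → u x = 0) ∧ ∀ x, |u x| ≤ b n := by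
    intro n
    refine exists_baireOne_eqOn_finset hY (A (n + 1) \ A n) (hb0 n) fun x hx => ?_
    rw [Finset.mem_sdiff] at hx
    split_ifs with h
    · simpa using hb0 n
    · exact hv n h x hx.1 hx.2
  choose u hu huA huY hub using hu
  have huniq : ∀ m n x, x ∈ A (m + 1) \ A m → x ∈ A (n + 1) \ A n → m = n := by
    intro m n x hm hn
    rw [Finset.mem_sdiff] at hm hn
    by_contra hmn
    rcases lt_or_gt_of_ne hmn with h | h
    · exact hn.2 (hA h hm.1)
    · exact hm.2 (hA h hn.1)
  refine ⟨fun x => f₁ x + f₀ x + ∑' n, u n x, (hf₁.add hf₀).add (BaireOne.tsum hu hb hub),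
    fun N x hxN => ?_⟩
  have hxY := hAY N x hxN
  by_cases hx0 : x ∈ A 0
  · have hx : ∀ n, x ∈ A n := fun n => hA (Nat.zero_le n) hx0
    have h1 : f₁ x = 0 := hf₁Y x hxY fun h => by
      obtain ⟨k, hk⟩ := mem_iUnion.1 h
      exact hk.2 (hx _)
    have h2 : ∀ n, u n x = 0 := fun n =>
      huY n x hxY fun h => (Finset.mem_sdiff.1 h).2 (hx n)
    simp [h1, h2, hf₀A x hx0]
  · obtain ⟨n, hn⟩ : ∃ n, x ∈ A (n + 1) \ A n := by
      have hex : ∃ n, x ∈ A n := ⟨N, hxN⟩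
      obtain ⟨n, hn⟩ := Nat.exists_eq_succ_of_ne_zero
        (fun h : Nat.find hex = 0 => hx0 (h ▸ Nat.find_spec hex))
      refine ⟨n, Finset.mem_sdiff.2 ⟨?_, Nat.find_min hex (by omega)⟩⟩
      have := Nat.find_spec hex
      rwa [hn] at this
    have h0 : f₀ x = 0 := hf₀Y x hxY hx0
    have hs : ∑' m, u m x = u n x := tsum_eq_single n fun m hm =>
      huY m x hxY fun h => hm (huniq m n x h hn)
    dsimp only
    rw [h0, hs, huA n x hn, add_zero]
    split_ifs with hnφ
    · obtain ⟨k, rfl⟩ := hnφ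
      rw [add_zero]
      exact hf₁φ x (mem_iUnion.2 ⟨k, by simpa using hn⟩)
    · rw [hf₁Y x hxY, zero_add]
      intro h
      obtain ⟨k, hk⟩ := mem_iUnion.1 h
      exact hnφ ⟨k, huniq _ _ x (by simpa using hk) hn⟩

lemma baireSpace_baireOne_of_finite [T35Space X] [Finite X] :
    BaireSpace {f : X → ℝ // BaireOne f} := by
  have h : IsClosed {f : X → ℝ | BaireOne f} := by
    have : {f : X → ℝ | BaireOne f} = univ :=
      eq_univ_of_forall fun f => (continuous_of_discreteTopology (f := f)).baireOne
    rw [this]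
    exact isClosed_univ
  cases nonempty_fintype X
  have : CompleteSpace {f : X → ℝ // BaireOne f} := h.completeSpace_coe
  infer_instance

theorem baireSpace_baireOne_of_infinite [T35Space X] [Infinite X]
    (H : ∀ Δ : ℕ → Set X, (∀ n, (Δ n).Finite ∧ (Δ n).Nonempty) →
      (Pairwise fun n m => Disjoint (Δ n) (Δ m)) →
      ∃ φ : ℕ → ℕ, StrictMono φ ∧ StronglyCozDeltaDisjoint (⋃ k, Δ (φ k))) :
    BaireSpace {f : X → ℝ // BaireOne f} := by
  refine ⟨fun G hGo hGd => dense_iff_inter_open.2 fun V hV ⟨f₀, hf₀⟩ => ?_⟩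
  -- a decreasing sequence of dense open sets
  set W : ℕ → Set {f : X → ℝ // BaireOne f} := fun n => {f | ∀ i < n + 1, f ∈ G i}
  have hWG : ∀ n, IsOpen {f | ∀ i < n, f ∈ G i} ∧ Dense {f | ∀ i < n, f ∈ G i} := by
    intro n
    induction n with
    | zero => simp
    | succ n ih =>
      have : {f | ∀ i < n + 1, f ∈ G i} = {f | ∀ i < n, f ∈ G i} ∩ G n := by
        ext f
        exact Nat.forall_lt_succ_right
      rw [this]
      exact ⟨ih.1.inter (hGo n), ih.2.inter_of_isOpen_left (hGd n) ih.1⟩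
  obtain ⟨s₀, ε, hε, hs₀⟩ := hV.exists_forall_abs_sub_lt_mem hf₀
  obtain ⟨S, hS0, hS⟩ := exists_seq_of_forall_exists_succ
    (α := Finset X × Finset ((X → ℝ) × ℝ)) (P := fun _ T => ∀ p ∈ T.2, 0 < p.2)
    (R := fun n T T' => T.1 ⊂ T'.1 ∧
      (∀ p ∈ T.2, ∃ q ∈ T'.2, q.2 ≤ (1 / 2 : ℝ) ^ n ∧
        (∀ x ∈ T.1, |q.1 x - p.1 x| + q.2 ≤ p.2) ∧ ∀ x ∈ T'.1, x ∉ T.1 → q.1 x = 0) ∧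
      ∀ p ∈ T.2, ∃ q ∈ T'.2, q.2 ≤ (1 / 2 : ℝ) ^ n ∧
        (∀ x ∈ T.1, |q.1 x - p.1 x| + q.2 ≤ p.2) ∧
        ∀ f : {f : X → ℝ // BaireOne f}, (∀ x ∈ T'.1, |f.1 x - q.1 x| ≤ q.2) → f ∈ W n)
    (a := (s₀, {(f₀.1, ε / 2)})) (by simpa using hε) (by
      intro n T hT
      obtain ⟨A', L', h1, h2⟩ := exists_finset_boxes_succ (hWG (n + 1)).1 (hWG (n + 1)).2
        (δ := (1 / 2 : ℝ) ^ n) (by positivity) T.1 T.2 hT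
      exact ⟨(A', L'), h1, h2⟩)
  set A : ℕ → Finset X := fun n => (S n).1 with hAdef
  have hAs : ∀ n, A n ⊂ A (n + 1) := fun n => (hS n).2.1
  have hA : Monotone A := monotone_nat_of_le_succ fun n => (hAs n).subset
  obtain ⟨φ, hφ, hφd⟩ := H (fun n => (A (n + 1) : Set X) \ A n)
    (fun n => ⟨(A (n + 1)).finite_toSet.subset sdiff_subset, by
      obtain ⟨x, hx, hx'⟩ := Finset.exists_of_ssubset (hAs n)
      exact ⟨x, hx, hx'⟩⟩)
    (pairwise_disjoint_on _ |>.2 fun m n hmn =>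
      disjoint_left.2 fun x hx hx' => hx'.2 (hA hmn hx.1))
  obtain ⟨p, hp0, hp⟩ := exists_seq_of_forall_exists_succ
    (P := fun n p => p ∈ (S n).2)
    (R := fun n p q => q.2 ≤ (1 / 2 : ℝ) ^ n ∧ (∀ x ∈ A n, |q.1 x - p.1 x| + q.2 ≤ p.2) ∧
      (n ∉ range φ → ∀ x ∈ A (n + 1), x ∉ A n → q.1 x = 0) ∧
      (n ∈ range φ → ∀ f : {f : X → ℝ // BaireOne f},
        (∀ x ∈ A (n + 1), |f.1 x - q.1 x| ≤ q.2) → f ∈ W n))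
    (a := (f₀.1, ε / 2)) (by rw [hS0]; exact Finset.mem_singleton_self _) (by
      intro n p hpn
      by_cases hn : n ∈ range φ
      · obtain ⟨q, hq, h1, h2, h3⟩ := (hS n).2.2.2 p hpn
        exact ⟨q, hq, h1, h2, fun h => absurd hn h, fun _ => h3⟩
      · obtain ⟨q, hq, h1, h2, h3⟩ := (hS n).2.2.1 p hpn
        exact ⟨q, hq, h1, h2, fun _ => h3, fun h => absurd h hn⟩)
  obtain ⟨v, hv⟩ := exists_forall_abs_sub_le_of_nested hA
    (fun n => ((hS n).1 _ (hp n).1).le) fun n => (hp n).2.2.1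
  obtain ⟨f, hf, hfv⟩ := exists_baireOne_eqOn_iUnion hA hφd summable_geometric_two
    (fun n => by positivity) (v := v) fun n hn x hx hx' => by
      have h1 := hv (n + 1) x hx
      rw [(hp n).2.2.2.1 hn x hx hx', sub_zero] at h1
      exact h1.trans (hp n).2.1
  have hfp : ∀ n, ∀ x ∈ A n, |f x - (p n).1 x| ≤ (p n).2 := fun n x hx =>
    (hfv n x hx).symm ▸ hv n x hx
  refine ⟨⟨f, hf⟩, hs₀ _ fun x hx => ?_, mem_iInter.2 fun i => ?_⟩
  · have h1 := hfp 0 x (by rw [hAdef]; dsimp only; rw [hS0]; exact hx)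
    rw [hp0] at h1
    dsimp only at h1 ⊢
    linarith
  · exact (hp (φ i)).2.2.2.2 ⟨i, rfl⟩ ⟨f, hf⟩ (hfp (φ i + 1)) i
      (Nat.lt_succ_of_le (hφ.id_le i))

end DisjointImpliesBaire

/-- For a Tychonoff space `X`, the space `B₁(X)` is Baire iff every
pairwise disjoint sequence of nonempty finite subsets of `X` has a strongly
Coz_δ-disjoint subsequence. -/
theorem statement2 {X : Type*} [TopologicalSpace X] [T35Space X] :
    BaireSpace {f : X → ℝ // BaireOne f} ↔
      ∀ Δ : ℕ → Set X,
        (∀ n, (Δ n).Finite ∧ (Δ n).Nonempty) →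
        (Pairwise fun n m => Disjoint (Δ n) (Δ m)) →
        ∃ φ : ℕ → ℕ, StrictMono φ ∧
          StronglyCozDeltaDisjoint (⋃ k, Δ (φ k)) := by
  constructor
  · intro _ Δ hΔ hd
    exact exists_strictMono_stronglyCozDeltaDisjoint (fun n => (hΔ n).1) hd
  · intro H
    rcases finite_or_infinite X with h | h
    · exact baireSpace_baireOne_of_finite
    · exact baireSpace_baireOne_of_infinite H
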